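/- arXiv:2605.21165 — 2 statements merged into one kernel-verified Lean document; each statement's English description precedes it below -/
import Mathlib

section
/- For every positive integer k, there exists a finite simple graph G that is k-connected and vertex-pancyclic but contains no pancyclic edge. -/
namespace SimpleGraph

section Cycles

variable {V W : Type*} {G : SimpleGraph V} {H : SimpleGraph W}

/-- The list `l` starts at `v`, has no repetition, and traversing it and returning to `v` follows
edges of `G`. -/
def IsCyclicList (G : SimpleGraph V) (v : V) (l : List V) : Prop :=
  l.head? = some v ∧ l.Nodup ∧ (l ++ [v]).IsChain G.Adj

theorem IsCyclicList.map {v : V} {l : List V} (h : G.IsCyclicList v l) (f : V → W)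
    (hf : ∀ x y, G.Adj x y → x ∈ l → y ∈ l → H.Adj (f x) (f y)) (hinj : Set.InjOn f {x | x ∈ l}) :
    H.IsCyclicList (f v) (l.map f) := by
  obtain ⟨hv, hnd, hc⟩ := h
  refine ⟨by simp [hv], hnd.map_on fun x hx y hy hxy ↦ hinj hx hy hxy, ?_⟩
  have hvl : v ∈ l := List.mem_of_mem_head? (by simp [hv])
  have hmap : l.map f ++ [f v] = (l ++ [v]).map f := by simp
  rw [hmap, List.isChain_map]
  refine List.IsChain.imp_of_mem_imp (fun x y hx hy hxy ↦ hf x y hxy ?_ ?_) hc <;> grind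

theorem exists_walk_of_isChain {l : List V} {u v : V} (hl : (u :: l).IsChain G.Adj)
    (hv : (u :: l).getLast (List.cons_ne_nil u l) = v) :
    ∃ p : G.Walk u v, p.support = u :: l := by
  subst hv
  exact ⟨Walk.ofSupport (u :: l) (List.cons_ne_nil u l) hl, Walk.support_ofSupport _ hl⟩

theorem IsCyclicList.exists_isCycle {v : V} {l : List V} (h : G.IsCyclicList v l)
    (hl : 3 ≤ l.length) : ∃ c : G.Walk v v, c.IsCycle ∧ c.length = l.length := by
  obtain ⟨hv, hnd, hc⟩ := h
  match l, hl with
  | x :: a :: l, hl =>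
    obtain rfl : x = v := by simpa using hv
    simp only [List.cons_append, List.isChain_cons_cons] at hc
    obtain ⟨p, hp⟩ := exists_walk_of_isChain (u := a) (v := x) hc.2 (by simp)
    have hlen : p.length = l.length + 1 := by simpa [hp] using p.length_support.symm
    refine ⟨.cons hc.1 p, ?_, by simp [hlen]⟩
    refine Walk.isCycle_iff_isPath_tail_and_le_length.2 ⟨?_, by simpa [hlen] using hl⟩
    have hpath : (a :: (l ++ [x])).Nodup :=
      (List.perm_append_singleton x (a :: l)).nodup_iff.2 hnd
    simpa [Walk.isPath_def, hp] using hpath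

theorem exists_adj_adj_of_mem_edges {u a b : V} {c : G.Walk u u} (hc : c.length = 3)
    (he : s(a, b) ∈ c.edges) : ∃ x, G.Adj b x ∧ G.Adj x a := by
  match c, hc with
  | .cons (v := p) h₁ (.cons (v := q) h₂ (.cons h₃ .nil)), _ =>
    simp only [Walk.edges_cons, Walk.edges_nil, List.mem_cons, Sym2.eq_iff,
      List.not_mem_nil, or_false] at he
    rcases he with (⟨rfl, rfl⟩ | ⟨rfl, rfl⟩) | (⟨rfl, rfl⟩ | ⟨rfl, rfl⟩) | ⟨rfl, rfl⟩ | ⟨rfl, rfl⟩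
    · exact ⟨q, h₂, h₃⟩
    · exact ⟨q, h₃.symm, h₂.symm⟩
    · exact ⟨u, h₃, h₁⟩
    · exact ⟨u, h₁.symm, h₃.symm⟩
    · exact ⟨p, h₁, h₂⟩
    · exact ⟨p, h₂.symm, h₁.symm⟩

theorem Walk.IsCycle.exists_adj_adj_adj_of_mem_edges {u a b : V} {c : G.Walk u u} (h : c.IsCycle)
    (hc : c.length = 4) (he : s(a, b) ∈ c.edges) :
    ∃ x y, G.Adj b x ∧ G.Adj x y ∧ G.Adj y a ∧ a ≠ x ∧ b ≠ y := by
  match c, hc with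
  | .cons (v := p) h₁ (.cons (v := q) h₂ (.cons (v := r) h₃ (.cons h₄ .nil))), _ =>
    have hnd := h.support_nodup
    simp at hnd
    simp only [Walk.edges_cons, Walk.edges_nil, List.mem_cons, Sym2.eq_iff,
      List.not_mem_nil, or_false] at he
    have := h₁.symm
    have := h₂.symm
    have := h₃.symm
    have := h₄.symm
    rcases he with (⟨rfl, rfl⟩ | ⟨rfl, rfl⟩) | (⟨rfl, rfl⟩ | ⟨rfl, rfl⟩) |
      (⟨rfl, rfl⟩ | ⟨rfl, rfl⟩) | ⟨rfl, rfl⟩ | ⟨rfl, rfl⟩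
    · exact ⟨q, r, by grind⟩
    · exact ⟨r, q, by grind⟩
    · exact ⟨r, u, by grind⟩
    · exact ⟨u, r, by grind⟩
    · exact ⟨u, p, by grind⟩
    · exact ⟨p, u, by grind⟩
    · exact ⟨p, q, by grind⟩
    · exact ⟨q, p, by grind⟩

end Cycles

/-- Three edge-disjoint graphs on `ZMod 7 × S`, each a blow-up of a 7-cycle (with steps `1`, `2`
and `4`, respectively); the three copies of each element of `ZMod 7 × S` form a triangle. -/
def linkedCycles (S : Type*) : SimpleGraph (Fin 3 × ZMod 7 × S) where
  Adj x y := x.1 = y.1 ∧ (y.2.1 = x.2.1 + 2 ^ (x.1 : ℕ) ∨ y.2.1 = x.2.1 - 2 ^ (x.1 : ℕ)) ∨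
    x.1 ≠ y.1 ∧ x.2 = y.2
  symm := ⟨by
    rintro ⟨i, a, s⟩ ⟨j, b, r⟩ (⟨rfl, rfl | rfl⟩ | ⟨h, h'⟩)
    · simp
    · simp
    · exact .inr ⟨h.symm, h'.symm⟩⟩
  loopless := ⟨by
    have : ∀ (i : Fin 3) (a : ZMod 7), ¬(a = a + 2 ^ (i : ℕ) ∨ a = a - 2 ^ (i : ℕ)) := by decide
    rintro ⟨i, a, s⟩ (⟨-, h⟩ | ⟨h, -⟩)
    · exact this i a h
    · exact h rfl⟩

namespace linkedCycles

variable {S T : Type*}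

theorem adj_iff {x y : Fin 3 × ZMod 7 × S} : (linkedCycles S).Adj x y ↔
    x.1 = y.1 ∧ (y.2.1 = x.2.1 + 2 ^ (x.1 : ℕ) ∨ y.2.1 = x.2.1 - 2 ^ (x.1 : ℕ)) ∨
      x.1 ≠ y.1 ∧ x.2 = y.2 :=
  Iff.rfl

instance [DecidableEq S] : DecidableRel (linkedCycles S).Adj :=
  fun _ _ ↦ decidable_of_iff' _ adj_iff

theorem not_adj_of_adj_of_adj {x y z : Fin 3 × ZMod 7 × S} (h : x.1 = y.1)
    (hxy : (linkedCycles S).Adj x y) (hyz : (linkedCycles S).Adj y z) :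
    ¬(linkedCycles S).Adj z x := by
  have step_ne : ∀ (i : Fin 3) (a : ZMod 7), ¬(a = a + 2 ^ (i : ℕ) ∨ a = a - 2 ^ (i : ℕ)) := by
    decide
  have no_triangle : ∀ (i : Fin 3) (a b c : ZMod 7),
      (b = a + 2 ^ (i : ℕ) ∨ b = a - 2 ^ (i : ℕ)) → (c = b + 2 ^ (i : ℕ) ∨ c = b - 2 ^ (i : ℕ)) →
      ¬(a = c + 2 ^ (i : ℕ) ∨ a = c - 2 ^ (i : ℕ)) := by decide
  obtain ⟨i, a, s⟩ := x
  obtain ⟨j, b, r⟩ := y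
  obtain ⟨l, c, q⟩ := z
  intro hzx
  simp only [adj_iff, Prod.mk.injEq] at *
  grind

theorem not_adj_of_adj_of_adj_of_adj {x y z w : Fin 3 × ZMod 7 × S} (h : x.1 ≠ y.1)
    (hxy : (linkedCycles S).Adj x y) (hyz : (linkedCycles S).Adj y z)
    (hzw : (linkedCycles S).Adj z w) (hxz : x ≠ z) (hyw : y ≠ w) :
    ¬(linkedCycles S).Adj w x := by
  have step_ne : ∀ (i : Fin 3) (a : ZMod 7), ¬(a = a + 2 ^ (i : ℕ) ∨ a = a - 2 ^ (i : ℕ)) := by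
    decide
  have disjoint : ∀ (i j : Fin 3) (a b : ZMod 7), i ≠ j →
      (b = a + 2 ^ (i : ℕ) ∨ b = a - 2 ^ (i : ℕ)) →
      ¬(a = b + 2 ^ (j : ℕ) ∨ a = b - 2 ^ (j : ℕ)) := by decide
  have no_four : ∀ i j k l : Fin 3, i ≠ j → j ≠ k → i ≠ k → j ≠ l → i ≠ l → k = l := by decide
  obtain ⟨i, a, s⟩ := x
  obtain ⟨j, b, r⟩ := y
  obtain ⟨k, c, q⟩ := z
  obtain ⟨l, d, p⟩ := w
  intro hzx
  simp only [adj_iff, Prod.mk.injEq, ne_eq, not_and] at *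
  rcases hxy with hxy | hxy
  · exact h hxy.1
  rcases hyz with hyz | hyz <;> rcases hzw with hzw | hzw <;> rcases hzx with hzx | hzx <;> grind

theorem not_exists_isCycle_length_three {V : Type*} (f : V → Fin 3 × ZMod 7 × S) {a b : V}
    (h : (f a).1 = (f b).1) : ¬∃ (u : V) (c : ((linkedCycles S).comap f).Walk u u),
      c.IsCycle ∧ c.length = 3 ∧ s(a, b) ∈ c.edges := by
  rintro ⟨u, c, -, hc, he⟩
  obtain ⟨x, hbx, hxa⟩ := exists_adj_adj_of_mem_edges hc he
  exact not_adj_of_adj_of_adj h (c.adj_of_mem_edges he) hbx hxa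

theorem not_exists_isCycle_length_four {V : Type*} {f : V → Fin 3 × ZMod 7 × S}
    (hf : f.Injective) {a b : V} (h : (f a).1 ≠ (f b).1) :
    ¬∃ (u : V) (c : ((linkedCycles S).comap f).Walk u u),
      c.IsCycle ∧ c.length = 4 ∧ s(a, b) ∈ c.edges := by
  rintro ⟨u, c, hcyc, hc, he⟩
  obtain ⟨x, y, hbx, hxy, hya, hax, hby⟩ := hcyc.exists_adj_adj_adj_of_mem_edges hc he
  exact not_adj_of_adj_of_adj_of_adj h (c.adj_of_mem_edges he) hbx hxy (hf.ne hax) (hf.ne hby) hya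

theorem connected_induce_compl {n t : ℕ} (e : Fin n ≃ Fin 3 × ZMod 7 × Fin t) {A : Finset (Fin n)}
    (hA : A.card < t) :
    (((linkedCycles (Fin t)).comap e).induce ((A : Set (Fin n))ᶜ)).Connected := by
  obtain ⟨s, hs⟩ : ∃ s : Fin t, ∀ x ∈ A, (e x).2.2 ≠ s := by
    by_contra! h
    have : Finset.univ ⊆ A.image fun x ↦ (e x).2.2 := fun s _ ↦ by simpa using h s
    have := (Finset.card_le_card this).trans Finset.card_image_le
    simp at this
    omega
  let K := ((linkedCycles (Fin t)).comap e).induce ((A : Set (Fin n))ᶜ)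
  let r (i : Fin 3) (a : ZMod 7) : ((A : Set (Fin n))ᶜ : Set (Fin n)) :=
    ⟨e.symm (i, a, s), fun h ↦ hs _ h (by simp)⟩
  have hstep (x : ((A : Set (Fin n))ᶜ : Set (Fin n))) :
      K.Reachable x (r (e x).1 ((e x).2.1 + 2 ^ ((e x).1 : ℕ))) :=
    Adj.reachable (by simp [K, r, adj_iff])
  have hlayer (i : Fin 3) (m : ℕ) : K.Reachable (r i 0) (r i (m * 2 ^ (i : ℕ))) := by
    induction m with
    | zero => simp
    | succ m ih =>
      have := hstep (r i (m * 2 ^ (i : ℕ)))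
      simp only [r, Equiv.apply_symm_apply] at this
      rw [Nat.cast_succ, add_one_mul]
      exact ih.trans this
  have hcyclic : ∀ (i : Fin 3) (a : ZMod 7), ∃ m : Fin 7, a = (m : ℕ) * 2 ^ (i : ℕ) := by decide
  have hcross (i : Fin 3) : K.Reachable (r 0 0) (r i 0) := by
    by_cases hi : 0 = i
    · rw [hi]
    · exact Adj.reachable (by simp [K, r, adj_iff, hi])
  have hroot (x : ((A : Set (Fin n))ᶜ : Set (Fin n))) : K.Reachable (r 0 0) x := by
    obtain ⟨m, hm⟩ := hcyclic (e x).1 ((e x).2.1 + 2 ^ ((e x).1 : ℕ))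
    have := hstep x
    rw [hm] at this
    exact ((hcross _).trans (hlayer _ m)).trans this.symm
  exact (connected_iff_exists_forall_reachable _).2 ⟨r 0 0, hroot⟩

theorem adj_affine (σ : S → T) (j : Fin 3) (b : ZMod 7) {x y : Fin 3 × ZMod 7 × S}
    (h : (linkedCycles S).Adj x y) :
    (linkedCycles T).Adj (x.1 + j, 2 ^ (j : ℕ) * x.2.1 + b, σ x.2.2)
      (y.1 + j, 2 ^ (j : ℕ) * y.2.1 + b, σ y.2.2) := by
  have key : ∀ i j : Fin 3, (2 : ZMod 7) ^ ((i + j : Fin 3) : ℕ) = 2 ^ (j : ℕ) * 2 ^ (i : ℕ) := by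
    decide
  obtain ⟨h, h' | h'⟩ | ⟨h, h'⟩ := h
  · exact .inl ⟨by simp [h], .inl (by simp only [h', key]; ring)⟩
  · exact .inl ⟨by simp [h], .inr (by simp only [h', key]; ring)⟩
  · exact .inr ⟨by simpa using h, by simp [h']⟩

/-- Some two consecutive elements of `l` lie in layer `i`. -/
def HasStepIn (i : Fin 3) (l : List (Fin 3 × ZMod 7 × S)) : Prop :=
  ¬l.IsChain fun x y ↦ ¬(x.1 = i ∧ y.1 = i)

instance (i : Fin 3) (l : List (Fin 3 × ZMod 7 × S)) : Decidable (HasStepIn i l) :=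
  inferInstanceAs (Decidable ¬_)

theorem HasStepIn.exists_eq_append {i : Fin 3} {l : List (Fin 3 × ZMod 7 × S)}
    (h : HasStepIn i l) :
    ∃ l₁ x y l₂, l = l₁ ++ x :: y :: l₂ ∧ x.1 = i ∧ y.1 = i := by
  contrapose! h
  rw [HasStepIn, not_not, List.isChain_iff_forall_rel_of_append_cons_cons]
  exact fun x y l₁ l₂ hl hxy ↦ h l₁ x y l₂ hl hxy.1 hxy.2

/-- The vertices `(i, a + d, s), …, (i, a + 7 * d, s)`. -/
def revolution (i : Fin 3) (a d : ZMod 7) (s : S) : List (Fin 3 × ZMod 7 × S) :=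
  [a + d, a + 2 * d, a + 3 * d, a + 4 * d, a + 5 * d, a + 6 * d, a].map (i, ·, s)

/-- A cyclic list through `(0, 0, 0)` of length `m` that has steps in all three layers and uses only
the first `b i` vertices of each part of layer `i`. -/
def LongCycle (b : Fin 3 → ℕ) (m : ℕ) : Prop :=
  ∃ l : List (Fin 3 × ZMod 7 × ℕ), (linkedCycles ℕ).IsCyclicList (0, 0, 0) l ∧ l.length = m ∧
    (∀ x ∈ l, x.2.2 < b x.1) ∧ ∀ i, HasStepIn i l

theorem LongCycle.mono {b b' : Fin 3 → ℕ} {m : ℕ} (h : LongCycle b m) (hb : b ≤ b') :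
    LongCycle b' m := by
  obtain ⟨l, hl, hm, hlt, hstep⟩ := h
  exact ⟨l, hl, hm, fun x hx ↦ (hlt x hx).trans_le (hb x.1), hstep⟩

theorem LongCycle.add_seven {b : Fin 3 → ℕ} {m : ℕ} (h : LongCycle b m) (i : Fin 3) :
    LongCycle (Function.update b i (b i + 1)) (m + 7) := by
  obtain ⟨l, ⟨hhead, hnd, hchain⟩, rfl, hlt, hstep⟩ := h
  obtain ⟨l₁, x, y, l₂, rfl, hx, hy⟩ := (hstep i).exists_eq_append
  rw [List.append_assoc, List.cons_append, List.cons_append,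
    List.isChain_append_cons_cons] at hchain
  obtain ⟨hchain₁, hxy, hchain₂⟩ := hchain
  obtain ⟨d, hd0, hd, hxd⟩ : ∃ d : ZMod 7, d ≠ 0 ∧ (d = 2 ^ (i : ℕ) ∨ d = -2 ^ (i : ℕ)) ∧
      y.2.1 = x.2.1 + d := by
    have hpow : ∀ i : Fin 3, (2 : ZMod 7) ^ (i : ℕ) ≠ 0 := by decide
    rw [adj_iff, hx, hy] at hxy
    obtain ⟨-, h | h⟩ | ⟨h, -⟩ := hxy
    · exact ⟨_, hpow i, .inl rfl, h⟩
    · exact ⟨_, neg_ne_zero.2 (hpow i), .inr rfl, by rw [h, sub_eq_add_neg]⟩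
    · exact absurd rfl h
  have hadj (a : ZMod 7) (s r : ℕ) : (linkedCycles ℕ).Adj (i, a, s) (i, a + d, r) := by
    rcases hd with rfl | rfl <;> simp [adj_iff, sub_eq_add_neg]
  have hnodup : ∀ a d : ZMod 7, d ≠ 0 →
    [a + d, a + 2 * d, a + 3 * d, a + 4 * d, a + 5 * d, a + 6 * d, a].Nodup := by decide
  have hnew : ∀ z ∈ revolution i x.2.1 d (b i), z.1 = i ∧ z.2.2 = b i := by
    simp [revolution]
  refine ⟨l₁ ++ x :: (revolution i x.2.1 d (b i) ++ y :: l₂), ⟨?_, ?_, ?_⟩, ?_, ?_, ?_⟩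
  · cases l₁ <;> simpa using hhead
  · have hrev : (revolution i x.2.1 d (b i)).Nodup :=
      (hnodup _ _ hd0).map fun _ _ h ↦ by simpa using h
    have hdisj : (l₁ ++ x :: y :: l₂).Disjoint (revolution i x.2.1 d (b i)) := by
      intro z hz hz'
      have := hlt z hz
      rw [(hnew z hz').1, (hnew z hz').2] at this
      exact this.false
    have hperm : (l₁ ++ x :: (revolution i x.2.1 d (b i) ++ y :: l₂)).Perm
        ((l₁ ++ x :: y :: l₂) ++ revolution i x.2.1 d (b i)) := by
      rw [List.append_assoc]
      refine .append_left _ (.cons _ ?_)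
      exact List.perm_append_comm
    rw [hperm.nodup_iff]
    exact hnd.append hrev hdisj
  · obtain ⟨i₁, a, s⟩ := x
    obtain ⟨i₂, c, r⟩ := y
    obtain rfl : i = i₁ := hx.symm
    obtain rfl : i = i₂ := hy.symm
    obtain rfl : c = a + d := hxd
    have hlink (k : ZMod 7) :
        (linkedCycles ℕ).Adj (i, a + k * d, b i) (i, a + (k + 1) * d, b i) := by
      convert hadj (a + k * d) (b i) (b i) using 3
      ring
    have hseven : a + (6 + 1) * d = a := by
      rw [show (6 + 1 : ZMod 7) = 0 from rfl, zero_mul, add_zero]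
    have h₁ := hlink 1
    have h₂ := hlink 2
    have h₃ := hlink 3
    have h₄ := hlink 4
    have h₅ := hlink 5
    have h₆ := hlink 6
    norm_num1 at h₁ h₂ h₃ h₄ h₅
    rw [one_mul] at h₁
    rw [hseven] at h₆
    simp only [revolution, List.map_cons, List.map_nil, List.cons_append, List.nil_append,
      List.append_assoc, List.isChain_append_cons_cons, List.isChain_cons_cons]
    exact ⟨hchain₁, hadj _ _ _, h₁, h₂, h₃, h₄, h₅, h₆, hadj _ _ _, hchain₂⟩
  · simp [revolution]
    omega
  · intro z hz
    by_cases hzn : z ∈ revolution i x.2.1 d (b i)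
    · simp [hnew z hzn]
    · have := hlt z (by simp at hz ⊢; tauto)
      rw [Function.update_apply]
      split_ifs with h
      · rw [h] at this
        omega
      · exact this
  · intro j
    by_cases hj : i = j
    · subst hj
      simp [HasStepIn, revolution, List.isChain_append]
    · refine fun hchain ↦ hstep j ?_
      have hchain₁ := (List.isChain_split.1 hchain).1
      rw [List.append_cons, ← List.append_assoc] at hchain
      exact List.isChain_append_cons_cons.2
        ⟨hchain₁, fun h ↦ hj (hx.symm.trans h.1), hchain.right_of_append⟩

/-- The 7-cycle of the vertices `(0, a, 0)`. -/
def firstRound : List (Fin 3 × ZMod 7 × ℕ) :=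
  [(0, 0, 0), (0, 1, 0), (0, 2, 0), (0, 3, 0), (0, 4, 0), (0, 5, 0), (0, 6, 0)]

theorem longCycle_of_le (t : ℕ) :
    ∀ m, 15 ≤ m → m ≤ 21 * (t + 1) → LongCycle (fun _ ↦ t + 1) m := by
  induction t with
  | zero =>
    intro m hm hmt
    have hbase {l : List (Fin 3 × ZMod 7 × ℕ)} (h : l.head? = some (0, 0, 0) ∧ l.Nodup ∧
        (l ++ [(0, 0, 0)]).IsChain (linkedCycles ℕ).Adj ∧ (∀ x ∈ l, x.2.2 < 1) ∧
        ∀ i, HasStepIn i l) : LongCycle (fun _ ↦ 0 + 1) l.length :=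
      ⟨l, ⟨h.1, h.2.1, h.2.2.1⟩, rfl, h.2.2.2⟩
    interval_cases m
    · exact hbase (l := firstRound ++
        [(1, 6, 0), (1, 1, 0), (1, 3, 0), (1, 5, 0), (2, 5, 0), (2, 1, 0), (2, 4, 0), (2, 0, 0)])
        (by decide)
    · exact hbase (l := firstRound ++
        [(1, 6, 0), (1, 1, 0), (1, 3, 0), (1, 5, 0), (1, 0, 0), (1, 2, 0), (1, 4, 0), (2, 4, 0),
         (2, 0, 0)]) (by decide)
    · exact hbase (l := firstRound ++
        [(1, 6, 0), (1, 1, 0), (1, 3, 0), (1, 5, 0), (1, 0, 0), (1, 2, 0), (2, 2, 0), (2, 6, 0),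
         (2, 3, 0), (2, 0, 0)]) (by decide)
    · exact hbase (l := firstRound ++
        [(1, 6, 0), (1, 1, 0), (1, 3, 0), (1, 5, 0), (1, 0, 0), (1, 2, 0), (2, 2, 0), (2, 5, 0),
         (2, 1, 0), (2, 4, 0), (2, 0, 0)]) (by decide)
    · exact hbase (l := firstRound ++
        [(1, 6, 0), (1, 1, 0), (1, 3, 0), (2, 3, 0), (2, 0, 0), (2, 4, 0), (1, 4, 0), (1, 2, 0),
         (2, 2, 0), (2, 5, 0), (1, 5, 0), (1, 0, 0)]) (by decide)
    · exact hbase (l := firstRound ++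
        [(1, 6, 0), (1, 1, 0), (1, 3, 0), (1, 5, 0), (2, 5, 0), (2, 1, 0), (2, 4, 0), (1, 4, 0),
         (1, 2, 0), (2, 2, 0), (2, 6, 0), (2, 3, 0), (2, 0, 0)]) (by decide)
    · exact hbase (l := firstRound ++
        [(1, 6, 0), (1, 1, 0), (1, 3, 0), (1, 5, 0), (1, 0, 0), (1, 2, 0), (1, 4, 0), (2, 4, 0),
         (2, 1, 0), (2, 5, 0), (2, 2, 0), (2, 6, 0), (2, 3, 0), (2, 0, 0)]) (by decide)
  | succ t ih =>
    intro m hm hmt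
    by_cases h₀ : m ≤ 21 * (t + 1)
    · exact (ih m hm h₀).mono fun _ ↦ by simp
    obtain ⟨p, rfl⟩ : ∃ p, m = p + 21 := ⟨m - 21, by omega⟩
    by_cases h₁ : p + 14 ≤ 21 * (t + 1)
    · refine ((ih (p + 14) (by omega) h₁).add_seven 0).mono ?_
      intro i; fin_cases i <;> simp
    by_cases h₂ : p + 7 ≤ 21 * (t + 1)
    · refine (((ih (p + 7) (by omega) h₂).add_seven 0).add_seven 1).mono ?_
      intro i; fin_cases i <;> simp
    · refine ((((ih p (by omega) (by omega)).add_seven 0).add_seven 1).add_seven 2).mono ?_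
      intro i; fin_cases i <;> simp

theorem exists_isCyclicList_of_le_fourteen {m : ℕ} (h3 : 3 ≤ m) (hm : m ≤ 14) :
    ∃ l : List (Fin 3 × ZMod 7 × ℕ),
      (linkedCycles ℕ).IsCyclicList (0, 0, 0) l ∧ l.length = m ∧ ∀ x ∈ l, x.2.2 < 2 := by
  have hbase {l : List (Fin 3 × ZMod 7 × ℕ)} (h : l.head? = some (0, 0, 0) ∧ l.Nodup ∧
      (l ++ [(0, 0, 0)]).IsChain (linkedCycles ℕ).Adj ∧ ∀ x ∈ l, x.2.2 < 2) :
      ∃ l' : List (Fin 3 × ZMod 7 × ℕ), (linkedCycles ℕ).IsCyclicList (0, 0, 0) l' ∧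
        l'.length = l.length ∧ ∀ x ∈ l', x.2.2 < 2 :=
    ⟨l, ⟨h.1, h.2.1, h.2.2.1⟩, rfl, h.2.2.2⟩
  interval_cases m
  · exact hbase (l := [(0, 0, 0), (1, 0, 0), (2, 0, 0)]) (by decide)
  · exact hbase (l := [(0, 0, 0), (0, 1, 0), (0, 0, 1), (0, 1, 1)]) (by decide)
  · exact hbase (l := [(0, 0, 0), (0, 1, 0), (0, 2, 0), (1, 2, 0), (1, 0, 0)]) (by decide)
  · exact hbase (l :=
      [(0, 0, 0), (0, 1, 0), (0, 2, 0), (0, 3, 0), (2, 3, 0), (2, 0, 0)]) (by decide)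
  · exact hbase (l := firstRound) (by decide)
  · exact hbase (l :=
      [(0, 0, 0), (0, 1, 0), (0, 2, 0), (0, 3, 0), (0, 4, 0), (0, 5, 0), (1, 5, 0), (1, 0, 0)])
      (by decide)
  · exact hbase (l :=
      [(0, 0, 0), (0, 1, 0), (0, 2, 0), (0, 3, 0), (0, 4, 0), (0, 5, 0), (1, 5, 0), (1, 0, 0),
       (2, 0, 0)]) (by decide)
  · exact hbase (l := firstRound ++ [(2, 6, 0), (2, 3, 0), (2, 0, 0)]) (by decide)
  · exact hbase (l := firstRound ++ [(1, 6, 0), (1, 4, 0), (1, 2, 0), (1, 0, 0)]) (by decide)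
  · exact hbase (l := firstRound ++
      [(1, 6, 0), (1, 1, 0), (1, 3, 0), (1, 5, 0), (1, 0, 0)]) (by decide)
  · exact hbase (l := firstRound ++
      [(1, 6, 0), (1, 1, 0), (1, 3, 0), (1, 5, 0), (1, 0, 0), (2, 0, 0)]) (by decide)
  · exact hbase (l := firstRound ++
      [(1, 6, 0), (1, 1, 0), (2, 1, 0), (2, 4, 0), (1, 4, 0), (1, 2, 0), (1, 0, 0)]) (by decide)

theorem exists_isCycle {n t m : ℕ} (e : Fin n ≃ Fin 3 × ZMod 7 × Fin t) (ht : 2 ≤ t) (h3 : 3 ≤ m)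
    (hm : m ≤ 21 * t) (v : Fin n) :
    ∃ c : ((linkedCycles (Fin t)).comap e).Walk v v, c.IsCycle ∧ c.length = m := by
  obtain ⟨l, hl, rfl, hlt⟩ : ∃ l : List (Fin 3 × ZMod 7 × ℕ),
      (linkedCycles ℕ).IsCyclicList (0, 0, 0) l ∧ l.length = m ∧ ∀ x ∈ l, x.2.2 < t := by
    by_cases h : m ≤ 14
    · obtain ⟨l, hl, hlm, hlt⟩ := exists_isCyclicList_of_le_fourteen h3 h
      exact ⟨l, hl, hlm, fun x hx ↦ (hlt x hx).trans_le ht⟩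
    · obtain ⟨r, rfl⟩ := Nat.exists_eq_add_of_le' (one_le_two.trans ht)
      obtain ⟨l, hl, hlm, hlt, -⟩ := longCycle_of_le r m (by omega) hm
      exact ⟨l, hl, hlm, hlt⟩
  have : NeZero t := ⟨by omega⟩
  obtain ⟨j, b, s, hv⟩ : ∃ j b s, e v = (j, b, s) := ⟨_, _, _, rfl⟩
  let σ (r : ℕ) : Fin t := Equiv.swap 0 s (Fin.ofNat t r)
  let f (x : Fin 3 × ZMod 7 × ℕ) : Fin n := e.symm (x.1 + j, 2 ^ (j : ℕ) * x.2.1 + b, σ x.2.2)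
  have hf₀ : f (0, 0, 0) = v := by
    rw [Equiv.symm_apply_eq, hv]
    simp [σ]
  have hcyc : ((linkedCycles (Fin t)).comap e).IsCyclicList (f (0, 0, 0)) (l.map f) := by
    refine hl.map f (fun x y h _ _ ↦ ?_) fun x hx y hy hxy ↦ ?_
    · simpa [f] using adj_affine σ j b h
    · have hpow : ∀ j : Fin 3, (2 : ZMod 7) ^ (j : ℕ) ≠ 0 := by decide
      have : Fact (Nat.Prime 7) := ⟨by norm_num⟩
      have h := e.symm.injective hxy
      have hσ := congrArg Fin.val ((Equiv.swap 0 s).injective (congrArg (·.2.2) h))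
      simp only [Prod.mk.injEq, add_left_inj] at h
      simp only [Fin.ofNat, Nat.mod_eq_of_lt (hlt x hx), Nat.mod_eq_of_lt (hlt y hy)] at hσ
      exact Prod.ext h.1 (Prod.ext (mul_left_cancel₀ (hpow j) h.2.1) hσ)
  rw [hf₀] at hcyc
  simpa using hcyc.exists_isCycle (by simpa using h3)

end linkedCycles
end SimpleGraph


/-- For every positive integer `k`, there exists a finite simple graph `G`
(on vertex set `Fin n`) that is `k`-connected and vertex-pancyclic but contains
no pancyclic edge.  Here `G` is `k`-connected means `n > k` and removing any set
of at most `k - 1` vertices leaves a connected graph; `G` is vertex-pancyclic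
means every vertex lies in a cycle of every length `m ∈ {3,…,n}`; and an edge is
pancyclic if it lies in a cycle of every length `m ∈ {3,…,n}`. -/
theorem exists_kConnected_vertexPancyclic_no_pancyclic_edge :
    ∀ k : ℕ, 0 < k →
    ∃ (n : ℕ) (G : SimpleGraph (Fin n)),
      3 ≤ n ∧
      -- `G` is `k`-connected
      (k < n ∧ ∀ S : Finset (Fin n), S.card ≤ k - 1 →
        (G.induce ((↑S : Set (Fin n))ᶜ)).Connected) ∧
      -- `G` is vertex-pancyclic
      (∀ v : Fin n, ∀ m : ℕ, 3 ≤ m → m ≤ n →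
        ∃ c : G.Walk v v, c.IsCycle ∧ c.length = m) ∧
      -- `G` has no pancyclic edge
      (∀ e ∈ G.edgeSet, ∃ m : ℕ, 3 ≤ m ∧ m ≤ n ∧
        ¬ ∃ (u : Fin n) (c : G.Walk u u), c.IsCycle ∧ c.length = m ∧ e ∈ c.edges) := by
  intro k hk
  obtain ⟨e⟩ : Nonempty (Fin (21 * (k + 1)) ≃ Fin 3 × ZMod 7 × Fin (k + 1)) := by
    refine ⟨Fintype.equivOfCardEq ?_⟩
    simp only [Fintype.card_fin, Fintype.card_prod, ZMod.card]
    ring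
  refine ⟨21 * (k + 1), (SimpleGraph.linkedCycles (Fin (k + 1))).comap e, by omega,
    ⟨by omega, fun A hA ↦ SimpleGraph.linkedCycles.connected_induce_compl e (by omega)⟩,
    fun v m h3 hm ↦ SimpleGraph.linkedCycles.exists_isCycle e (by omega) h3 hm v, ?_⟩
  intro edge _
  induction edge with
  | _ a b =>
    by_cases h : (e a).1 = (e b).1
    · exact ⟨3, le_rfl, by omega,
        SimpleGraph.linkedCycles.not_exists_isCycle_length_three e h⟩
    · exact ⟨4, by omega, by omega,
        SimpleGraph.linkedCycles.not_exists_isCycle_length_four e.injective h⟩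
end

section
/- For each ℓ ∈ {3,4,5,6,7,8} there exists a sequence z_1, z_2, …, z_ℓ of pairwise distinct elements of Q with z_1 = (0,0,0) such that: (a) for each consecutive pair, z_t + z_{t+1} lies in exactly one of P_0, P_1, P_2, and the resulting color sequence c_1, …, c_{ℓ−1} (where z_t + z_{t+1} ∈ P_{c_t}) satisfies c_t ≠ c_{t+1} for all t; (b) c_1 = 1; (c) z_ℓ ∈ P_2; and (d) c_{ℓ−1} ≠ 2. -/
abbrev Q : Type := ZMod 2 × ZMod 2 × ZMod 2

def P : Fin 3 → Set Q :=
  ![{(1,0,0), (0,1,0)}, {(0,0,1), (1,1,0), (1,0,1)}, {(0,1,1), (1,1,1)}]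

/-- The index of the part containing a nonzero element of `Q`. -/
def color (x : Q) : Fin 3 :=
  if x = (1, 0, 0) ∨ x = (0, 1, 0) then 0
  else if x = (0, 1, 1) ∨ x = (1, 1, 1) then 2
  else 1

theorem mem_P_iff (x : Q) (j : Fin 3) : x ∈ P j ↔ x ≠ 0 ∧ color x = j := by
  fin_cases j <;> simp only [P, Fin.zero_eta, Fin.mk_one, Fin.reduceFinMk, Matrix.cons_val,
    Set.mem_insert_iff, Set.mem_singleton_iff] <;> revert x <;> decide

/-- The first `ℓ` entries of `l` form a properly colored path from `0`, with first color `1`, last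
color other than `2`, and an endpoint of color `2`. -/
def IsColoredPath (ℓ : ℕ) (l : List Q) : Prop :=
  (∀ s < ℓ, ∀ t < ℓ, s ≠ t → l.getD s 0 ≠ l.getD t 0) ∧
  l.getD 0 0 = (0, 0, 0) ∧
  (∀ t < ℓ - 1, l.getD t 0 + l.getD (t + 1) 0 ≠ 0) ∧
  (∀ t < ℓ - 2, color (l.getD t 0 + l.getD (t + 1) 0) ≠
    color (l.getD (t + 1) 0 + l.getD (t + 2) 0)) ∧
  color (l.getD 0 0 + l.getD 1 0) = 1 ∧
  (l.getD (ℓ - 1) 0 ≠ 0 ∧ color (l.getD (ℓ - 1) 0) = 2) ∧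
  color (l.getD (ℓ - 2) 0 + l.getD (ℓ - 2 + 1) 0) ≠ 2

set_option synthInstance.maxSize 1000 in
instance (ℓ : ℕ) (l : List Q) : Decidable (IsColoredPath ℓ l) := by
  unfold IsColoredPath
  infer_instance

theorem IsColoredPath.exists_path {ℓ : ℕ} {l : List Q} (h : IsColoredPath ℓ l) :
    ∃ (z : ℕ → Q) (c : ℕ → Fin 3),
      (∀ s t : ℕ, s < ℓ → t < ℓ → s ≠ t → z s ≠ z t) ∧
      z 0 = (0, 0, 0) ∧
      (∀ t : ℕ, t + 1 < ℓ → z t + z (t + 1) ∈ P (c t)) ∧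
      (∀ t : ℕ, t + 1 < ℓ → ∀ j : Fin 3, z t + z (t + 1) ∈ P j → j = c t) ∧
      (∀ t : ℕ, t + 2 < ℓ → c t ≠ c (t + 1)) ∧
      c 0 = 1 ∧
      z (ℓ - 1) ∈ P 2 ∧
      c (ℓ - 2) ≠ 2 := by
  obtain ⟨hinj, hzero, hne, hcolor, hfirst, hend, hlast⟩ := h
  exact ⟨fun t => l.getD t 0, fun t => color (l.getD t 0 + l.getD (t + 1) 0),
    fun s t hs ht => hinj s hs t ht, hzero,
    fun t ht => (mem_P_iff _ _).2 ⟨hne t (by omega), rfl⟩,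
    fun t _ j hj => ((mem_P_iff _ _).1 hj).2.symm,
    fun t ht => hcolor t (by omega), hfirst, (mem_P_iff _ _).2 hend, hlast⟩

/-- For each `ℓ ∈ {3,…,8}` there is a sequence `z 0, z 1, …, z (ℓ-1)` of
pairwise distinct elements of `Q` starting at `(0,0,0)` such that: (a) each
consecutive sum `z t + z (t+1)` lies in exactly one of `P 0, P 1, P 2`, and
the resulting colors `c t` (with `z t + z (t+1) ∈ P (c t)`) satisfy
`c t ≠ c (t+1)`; (b) `c 0 = 1`; (c) `z (ℓ-1) ∈ P 2`; and (d) `c (ℓ-2) ≠ 2`. -/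
theorem exists_properly_colored_path :
    ∀ ℓ : ℕ, 3 ≤ ℓ → ℓ ≤ 8 →
    ∃ (z : ℕ → Q) (c : ℕ → Fin 3),
      (∀ s t : ℕ, s < ℓ → t < ℓ → s ≠ t → z s ≠ z t) ∧
      z 0 = (0, 0, 0) ∧
      (∀ t : ℕ, t + 1 < ℓ → z t + z (t + 1) ∈ P (c t)) ∧
      (∀ t : ℕ, t + 1 < ℓ → ∀ j : Fin 3, z t + z (t + 1) ∈ P j → j = c t) ∧
      (∀ t : ℕ, t + 2 < ℓ → c t ≠ c (t + 1)) ∧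
      c 0 = 1 ∧
      z (ℓ - 1) ∈ P 2 ∧
      c (ℓ - 2) ≠ 2 := by
  intro ℓ h₃ h₈
  interval_cases ℓ
  · exact IsColoredPath.exists_path
      (l := [(0, 0, 0), (0, 0, 1), (0, 1, 1)]) (by decide)
  · exact IsColoredPath.exists_path
      (l := [(0, 0, 0), (0, 0, 1), (0, 1, 0), (0, 1, 1)]) (by decide)
  · exact IsColoredPath.exists_path
      (l := [(0, 0, 0), (0, 0, 1), (0, 1, 0), (0, 1, 1), (1, 1, 1)]) (by decide)
  · exact IsColoredPath.exists_path
      (l := [(0, 0, 0), (0, 0, 1), (0, 1, 0), (1, 0, 0), (0, 1, 1), (1, 1, 1)]) (by decide)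
  · exact IsColoredPath.exists_path
      (l := [(0, 0, 0), (0, 0, 1), (0, 1, 0), (0, 1, 1), (1, 0, 0), (1, 0, 1), (1, 1, 1)])
      (by decide)
  · exact IsColoredPath.exists_path
      (l := [(0, 0, 0), (0, 0, 1), (0, 1, 0), (0, 1, 1), (1, 0, 0), (1, 0, 1), (1, 1, 0), (1, 1, 1)])
      (by decide)
end
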